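/- arXiv:2003.13152 — 2 statements merged into one kernel-verified Lean document; each statement's English description precedes it below -/
import Mathlib

section
/- Let a, b be positive integers and let W ∈ Inc^q(a × b) with W(1,1) = 1. Then Ψ(W)(a,b) = q, where Ψ denotes K-promotion. -/
open scoped Classical

/-- Two boxes of the `a × b` grid are adjacent if they share an edge. -/
def Adj {a b : ℕ} (x y : Fin a × Fin b) : Prop :=
  (x.1 = y.1 ∧ ((x.2 : ℕ) + 1 = (y.2 : ℕ) ∨ (y.2 : ℕ) + 1 = (x.2 : ℕ))) ∨
  (x.2 = y.2 ∧ ((x.1 : ℕ) + 1 = (y.1 : ℕ) ∨ (y.1 : ℕ) + 1 = (x.1 : ℕ)))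

/-- `IncTab a b q T` says `T` is an increasing tableau of shape `a × b`
(rows strictly increase left-to-right, columns strictly increase top-to-bottom)
with positive entries, all at most `q`; i.e. `T ∈ Inc^q(a × b)`. -/
def IncTab (a b q : ℕ) (T : Fin a × Fin b → ℕ) : Prop :=
  (∀ x, 1 ≤ T x ∧ T x ≤ q) ∧
  (∀ (i : Fin a) (j₁ j₂ : Fin b), j₁ < j₂ → T (i, j₁) < T (i, j₂)) ∧
  (∀ (i₁ i₂ : Fin a) (j : Fin b), i₁ < i₂ → T (i₁, j) < T (i₂, j))

/-- In the filling `f`, boxes `x` and `y` lie in a common edge-connected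
component (short ribbon) of the set of boxes labeled `1` or `t`. -/
def SameRibbon {a b : ℕ} (t : ℕ) (f : Fin a × Fin b → ℕ) (x y : Fin a × Fin b) : Prop :=
  Relation.ReflTransGen
    (fun u v => Adj u v ∧ (f u = 1 ∨ f u = t) ∧ (f v = 1 ∨ f v = t)) x y

/-- One step of the K-promotion algorithm at value `t`: in every nontrivial
edge-connected component of the set of boxes labeled `1` or `t`, the labels
`1` and `t` are swapped; boxes in trivial components are unchanged. -/
noncomputable def BKstep {a b : ℕ} (t : ℕ) (f : Fin a × Fin b → ℕ) :
    Fin a × Fin b → ℕ := fun x =>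
  if ∃ y, y ≠ x ∧ SameRibbon t f x y then
    (if f x = 1 then t else if f x = t then 1 else f x)
  else f x

/-- The intermediate filling obtained from `f` after performing the swap steps
for the values `2, 3, …, t - 1` (so `sweepUpTo t f` is the filling in force
when the step for value `t` is about to be performed). -/
noncomputable def sweepUpTo {a b : ℕ} (t : ℕ) (f : Fin a × Fin b → ℕ) :
    Fin a × Fin b → ℕ :=
  (List.range' 2 (t - 2)).foldl (fun g s => BKstep s g) f

/-- K-promotion `Ψ : Inc^q(a × b) → Inc^q(a × b)`: perform the swap steps for
`t = 2, …, q`, then decrement every entry by `1`, replacing a resulting `0`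
by `q`. -/
noncomputable def KPro {a b : ℕ} (q : ℕ) (T : Fin a × Fin b → ℕ) :
    Fin a × Fin b → ℕ := fun x =>
  if sweepUpTo (q + 1) T x = 1 then q else sweepUpTo (q + 1) T x - 1

/-- The Ψ-orbit of `T` under K-promotion. -/
noncomputable def PsiOrbit {a b : ℕ} (q : ℕ) (T : Fin a × Fin b → ℕ) :
    Set (Fin a × Fin b → ℕ) :=
  {U | ∃ n : ℕ, (KPro q)^[n] T = U}

/-- The pair `{x, y}` of adjacent boxes belongs to the flow path of `V`:
at the step for some value `t ∈ {2, …, q}`, both boxes carry label `1` or `t`,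
so they form part of a common nontrivial short ribbon whose labels are swapped. -/
def FlowPath {a b : ℕ} (q : ℕ) (V : Fin a × Fin b → ℕ) (x y : Fin a × Fin b) : Prop :=
  Adj x y ∧ ∃ t, 2 ≤ t ∧ t ≤ q ∧
    (sweepUpTo t V x = 1 ∨ sweepUpTo t V x = t) ∧
    (sweepUpTo t V y = 1 ∨ sweepUpTo t V y = t)

/-- The stream-bed of `V`: boxes appearing in some pair of the flow path. -/
def StreamBed {a b : ℕ} (q : ℕ) (V : Fin a × Fin b → ℕ) (x : Fin a × Fin b) : Prop :=
  ∃ y, FlowPath q V x y ∨ FlowPath q V y x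

/-- The box `x` lies in the frame of the `a × b` grid (first or last row,
or first or last column). -/
def InFrame {a b : ℕ} (x : Fin a × Fin b) : Prop :=
  (x.1 : ℕ) = 0 ∨ (x.1 : ℕ) = a - 1 ∨ (x.2 : ℕ) = 0 ∨ (x.2 : ℕ) = b - 1

/-- `Frame(V) = Frame(W)`: the fillings agree on all frame boxes. -/
def FrameEq {a b : ℕ} (V W : Fin a × Fin b → ℕ) : Prop :=
  ∀ x, InFrame x → V x = W x

/-- The minimal tableau `M_{a×b}`, with entries `M(i,j) = i + j - 1`
(in 1-based coordinates; here coordinates are 0-based). -/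
def MinTab (a b : ℕ) : Fin a × Fin b → ℕ := fun x => (x.1 : ℕ) + (x.2 : ℕ) + 1

/-- `y` is directly right of or below `x`. -/
def Cov {a b : ℕ} (x y : Fin a × Fin b) : Prop :=
  (x.1 = y.1 ∧ (x.2 : ℕ) + 1 = (y.2 : ℕ)) ∨ (x.2 = y.2 ∧ (x.1 : ℕ) + 1 = (y.1 : ℕ))

def wt (t v : ℕ) : ℕ := if v = 1 then 2 * t - 1 else 2 * v

def KInv {a b : ℕ} (q t : ℕ) (f : Fin a × Fin b → ℕ) : Prop :=
  (∃ x, f x = 1) ∧ (∀ x, f x ≤ q) ∧ ∀ x y, Cov x y → wt t (f x) < wt t (f y)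

lemma adj_iff {a b : ℕ} (x y : Fin a × Fin b) : Adj x y ↔ Cov x y ∨ Cov y x := by
  unfold Adj Cov
  rw [eq_comm (a := y.1), eq_comm (a := y.2)]
  tauto

lemma adj_ne {a b : ℕ} {x y : Fin a × Fin b} (h : Adj x y) : y ≠ x := by
  rintro rfl
  rcases h with ⟨_, h⟩ | ⟨_, h⟩ <;> omega

lemma step_swap {a b : ℕ} (t : ℕ) (f : Fin a × Fin b → ℕ) {x y : Fin a × Fin b}
    (h : Adj x y) (hx : f x = 1 ∨ f x = t) (hy : f y = 1 ∨ f y = t) :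
    BKstep t f x = (if f x = 1 then t else if f x = t then 1 else f x) := by
  unfold BKstep
  rw [if_pos]
  exact ⟨y, adj_ne h, Relation.ReflTransGen.single ⟨h, hx, hy⟩⟩

lemma step_cases {a b : ℕ} (t : ℕ) (f : Fin a × Fin b → ℕ) (x : Fin a × Fin b) :
    BKstep t f x = f x ∨ (f x = 1 ∧ BKstep t f x = t) ∨ (f x = t ∧ BKstep t f x = 1) := by
  unfold BKstep
  split_ifs <;> simp_all

lemma inv_step {a b : ℕ} (q t : ℕ) (f : Fin a × Fin b → ℕ) (h2 : 2 ≤ t) (hq : t ≤ q)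
    (h : KInv q t f) : KInv q (t + 1) (BKstep t f) := by
  obtain ⟨⟨x, hx⟩, hle, hc⟩ := h
  have hswap : ∀ x y, Adj x y → f x = 1 → f y = t →
      BKstep t f x = t ∧ BKstep t f y = 1 := by
    intro x y hxy h1 ht
    have hyx : Adj y x := by rw [adj_iff] at *; tauto
    rw [step_swap t f hxy (Or.inl h1) (Or.inr ht), step_swap t f hyx (Or.inr ht) (Or.inl h1)]
    rw [if_pos h1, if_neg (by omega), if_pos ht]
    exact ⟨rfl, rfl⟩
  refine ⟨?_, ?_, ?_⟩
  · by_cases hB : BKstep t f x = 1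
    · exact ⟨x, hB⟩
    · have : ∃ y, y ≠ x ∧ SameRibbon t f x y := by
        by_contra hn
        apply hB
        unfold BKstep
        rw [if_neg hn, hx]
      obtain ⟨y, hyx, hr⟩ := this
      rcases Relation.ReflTransGen.cases_head hr with h | ⟨z, ⟨hz, -, h1 | h1⟩, -⟩
      · exact absurd h.symm hyx
      · rcases (adj_iff _ _).1 hz with h | h <;> have := hc _ _ h <;> simp [hx, h1] at this
      · exact ⟨z, (hswap x z hz hx h1).2⟩
  · intro x
    have := hle x
    rcases step_cases t f x with h | ⟨_, h⟩ | ⟨_, h⟩ <;> omega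
  · intro x y hxy
    have hw := hc x y hxy
    have hA : Adj x y := (adj_iff _ _).2 (Or.inl hxy)
    by_cases hs : f x = 1 ∧ f y = t
    · obtain ⟨e1, e2⟩ := hswap x y hA hs.1 hs.2
      rw [e1, e2]
      unfold wt
      split_ifs <;> omega
    · unfold wt at *
      rcases step_cases t f x with h | ⟨_, h⟩ | ⟨_, h⟩ <;>
      rcases step_cases t f y with h' | ⟨_, h'⟩ | ⟨_, h'⟩ <;> rw [h, h'] <;>
      split_ifs at * <;> omega

lemma inv_sweep {a b : ℕ} (q : ℕ) (W : Fin a × Fin b → ℕ) (h : KInv q 2 W) (n : ℕ)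
    (hn : n + 1 ≤ q) : KInv q (n + 2) (sweepUpTo (n + 2) W) := by
  induction n with
  | zero => simpa [sweepUpTo] using h
  | succ n ih =>
    have := inv_step q (n + 2) _ (by omega) (by omega) (ih (by omega))
    have e : sweepUpTo (n + 1 + 2) W = BKstep (n + 2) (sweepUpTo (n + 2) W) := by
      simp [sweepUpTo, List.range'_concat, Nat.add_comm]
    rw [e]
    exact this

/-- Let `W ∈ Inc^q(a × b)` with `W(1,1) = 1`. Then `Ψ(W)(a,b) = q`
(corners in 1-based coordinates; here 0-based). -/
theorem kpromotion_corner (a b : ℕ) (ha : 0 < a) (hb : 0 < b)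
    (q : ℕ) (W : Fin a × Fin b → ℕ) (hW : IncTab a b q W)
    (h11 : W (⟨0, ha⟩, ⟨0, hb⟩) = 1) :
    KPro q W (⟨a - 1, Nat.sub_lt ha Nat.one_pos⟩, ⟨b - 1, Nat.sub_lt hb Nat.one_pos⟩) = q := by
  obtain ⟨hb1, hr, hcol⟩ := hW
  have hq : 1 ≤ q := by have := hb1 (⟨0, ha⟩, ⟨0, hb⟩); omega
  have h0 : KInv q 2 W := by
    refine ⟨⟨_, h11⟩, fun x => (hb1 x).2, ?_⟩
    rintro ⟨i, j⟩ ⟨k, l⟩ hxy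
    have h1 := (hb1 (i, j)).1
    have hlt : W (i, j) < W (k, l) := by
      rcases hxy with ⟨e, h⟩ | ⟨e, h⟩ <;> simp only at e h <;> subst e
      · exact hr _ _ _ (Fin.lt_def.2 (by omega))
      · exact hcol _ _ _ (Fin.lt_def.2 (by omega))
    unfold wt
    split_ifs <;> omega
  obtain ⟨⟨⟨i, j⟩, hx⟩, hle, hc⟩ := inv_sweep q W h0 (q - 1) (by omega)
  have e : q - 1 + 2 = q + 1 := by omega
  rw [e] at hx hle hc
  have key : ∀ y, ¬ Cov (i, j) y := by
    intro y hy
    have h1 := hc _ _ hy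
    have h2 := hle y
    rw [hx] at h1
    unfold wt at h1
    split_ifs at h1 <;> omega
  have hi : (i : ℕ) = a - 1 := by
    by_contra hne
    exact key (⟨i + 1, by omega⟩, j) (Or.inr ⟨rfl, rfl⟩)
  have hj : (j : ℕ) = b - 1 := by
    by_contra hne
    exact key (i, ⟨j + 1, by omega⟩) (Or.inl ⟨rfl, rfl⟩)
  have hE : ((⟨a - 1, Nat.sub_lt ha Nat.one_pos⟩, ⟨b - 1, Nat.sub_lt hb Nat.one_pos⟩) :
      Fin a × Fin b) = (i, j) := by
    ext <;> simp [hi, hj]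
  rw [hE]
  unfold KPro
  rw [if_pos hx]
end

section
/- Let a, b be positive integers with the shape a × b containing at least two boxes (i.e., ab > 1), and suppose V ∈ Inc^ℓ(a × b) satisfies Frame(V) = Frame(Ψ(V)), where Ψ denotes K-promotion. Then every box of the frame of a × b lies in the stream-bed of V. -/
open scoped Classical

theorem sweep_succ_aux {a b : ℕ} (t : ℕ) (ht : 2 ≤ t) (f : Fin a × Fin b → ℕ) :
    sweepUpTo (t + 1) f = BKstep t (sweepUpTo t f) := by
  obtain ⟨k, rfl⟩ := Nat.exists_eq_add_of_le ht
  have h1 : 2 + k + 1 - 2 = k + 1 := by omega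
  have h2 : 2 + k - 2 = k := by omega
  simp [sweepUpTo, h1, h2, List.range'_concat, List.foldl_append]

theorem sweep_fixed_aux {a b q : ℕ} (V : Fin a × Fin b → ℕ) (x : Fin a × Fin b)
    (hx : ¬ StreamBed q V x) (k : ℕ) (hk : k + 2 ≤ q + 1) : sweepUpTo (k + 2) V x = V x := by
  induction k with
  | zero => simp [sweepUpTo]
  | succ k ih =>
    have ih' := ih (by omega)
    rw [show k + 1 + 2 = (k + 2) + 1 by ring, sweep_succ_aux _ (by omega)]
    rw [BKstep, if_neg, ih']
    rintro ⟨y, hy, hr⟩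
    rcases Relation.ReflTransGen.cases_head hr with h | ⟨z, ⟨hz1, hz2, hz3⟩, -⟩
    · exact hy h.symm
    · exact hx ⟨z, Or.inl ⟨hz1, k + 2, by omega, by omega, hz2, hz3⟩⟩

/-- Let `a × b` contain at least two boxes and suppose `V ∈ Inc^ℓ(a × b)`
satisfies `Frame(V) = Frame(Ψ(V))`. Then every box of the frame of `a × b`
lies in the stream-bed of `V`. -/
theorem frame_fixed_frame_in_streamBed (a b : ℕ) (ha : 0 < a) (hb : 0 < b)
    (hab : 1 < a * b) (ℓ : ℕ) (V : Fin a × Fin b → ℕ) (hV : IncTab a b ℓ V)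
    (hframe : FrameEq V (KPro ℓ V)) :
    ∀ x : Fin a × Fin b, InFrame x → StreamBed ℓ V x := by
  intro x hx
  by_contra hs
  have hq : 1 ≤ ℓ := (hV.1 x).1.trans (hV.1 x).2
  have h1 : sweepUpTo (ℓ + 1) V x = V x := by
    have := sweep_fixed_aux V x hs (ℓ - 1) (by omega)
    rwa [show ℓ - 1 + 2 = ℓ + 1 by omega] at this
  have h2 := hframe x hx
  have hp := (hV.1 x).1
  simp only [KPro, h1] at h2
  have hl : ℓ = 1 := by
    split_ifs at h2 <;> omega
  subst hl
  have hone : ∀ y, V y = 1 := fun y => le_antisymm (hV.1 y).2 (hV.1 y).1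
  have hc : 1 < a ∨ 1 < b := by
    by_contra h
    have ha1 : a = 1 := by omega
    have hb1 : b = 1 := by omega
    subst ha1 hb1
    omega
  rcases hc with h | h
  · have := hV.2.2 ⟨0, ha⟩ ⟨1, h⟩ ⟨0, hb⟩ (by simp)
    simp [hone] at this
  · have := hV.2.1 ⟨0, ha⟩ ⟨0, hb⟩ ⟨1, h⟩ (by simp)
    simp [hone] at this
end
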